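/- Let Γ be a graph on vertex set V and σ a {±1}-valued function on unordered pairs of distinct vertices, and let Γ̂ be the double cover on V × {±1} where (x,ε) ~ (y,ε′) iff x ~ y in Γ and εε′ = σ(x,y). Suppose every triple of vertices lying on a geodesic path in Γ is coherent (σ(x,y)σ(y,z)σ(z,x)=1 whenever d(x,y)+d(y,z)=d(x,z)). Then every geodesic path x₀ ~ x₁ ~ ⋯ ~ x_k in Γ lifts to exactly two paths in Γ̂, and in any lift, ε_i = ε₀ σ(x₀, x_i) for all i ≥ 1. -/

import Mathlib

/-- Let `Γ` be a graph with a `{±1}`-valued sign function `σ` on pairs of vertices, and let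
`Γ̂` be the double cover on `V × {±1}` where `(x,ε) ~ (y,ε')` iff `x ~ y` and `εε' = σ(x,y)`.
Suppose every triple of vertices on a geodesic is coherent. Then every geodesic path
`x₀ ~ x₁ ~ ⋯ ~ x_k` in `Γ` lifts to exactly two paths in `Γ̂` (a unique lift for each of the
two choices of `ε₀`), and in any lift, `ε_i = ε₀ σ(x₀, x_i)` for all `i ≥ 1`. -/
theorem geodesic_lifts_to_two_paths {V : Type*} (G : SimpleGraph V) (σ : V → V → ℤˣ)
    (hsym : ∀ x y : V, σ x y = σ y x)
    (hcoh : ∀ x y z : V, G.dist x y + G.dist y z = G.dist x z → σ x y * σ y z * σ z x = 1)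
    (k : ℕ) (hk : 1 ≤ k) (x : Fin (k + 1) → V)
    (hadj : ∀ i : Fin k, G.Adj (x i.castSucc) (x i.succ))
    (hgeo : ∀ i j : Fin (k + 1), i ≤ j → G.dist (x i) (x j) = (j : ℕ) - (i : ℕ)) :
    (∀ e₀ : ℤˣ, ∃! ε : Fin (k + 1) → ℤˣ, ε 0 = e₀ ∧
        ∀ i : Fin k, G.Adj (x i.castSucc) (x i.succ) ∧
          ε i.castSucc * ε i.succ = σ (x i.castSucc) (x i.succ)) ∧
      (∀ ε : Fin (k + 1) → ℤˣ,
        (∀ i : Fin k, G.Adj (x i.castSucc) (x i.succ) ∧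
          ε i.castSucc * ε i.succ = σ (x i.castSucc) (x i.succ)) →
        ∀ i : Fin (k + 1), 1 ≤ (i : ℕ) → ε i = ε 0 * σ (x 0) (x i)) := by
  have sq : ∀ u : ℤˣ, u * u = 1 := Int.units_mul_self
  have h00 : σ (x 0) (x 0) = 1 := by
    have h := hcoh (x 0) (x 0) (x 0) (by simp)
    rwa [sq, one_mul] at h
  have key : ∀ i : Fin k, σ (x 0) (x i.castSucc) * σ (x i.castSucc) (x i.succ)
      = σ (x 0) (x i.succ) := by
    intro i
    have h := hcoh (x 0) (x i.castSucc) (x i.succ) (by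
      rw [hgeo _ _ (Fin.zero_le _), hgeo _ _ (Fin.zero_le _),
        hgeo _ _ (Fin.castSucc_lt_succ).le]
      simp)
    rw [hsym (x i.succ) (x 0)] at h
    calc _ = σ (x 0) (x i.castSucc) * σ (x i.castSucc) (x i.succ) *
          (σ (x 0) (x i.succ) * σ (x 0) (x i.succ)) := by rw [sq, mul_one]
      _ = _ := by rw [← mul_assoc, h, one_mul]
  have main : ∀ ε : Fin (k + 1) → ℤˣ,
      (∀ i : Fin k, G.Adj (x i.castSucc) (x i.succ) ∧
        ε i.castSucc * ε i.succ = σ (x i.castSucc) (x i.succ)) →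
      ∀ i : Fin (k + 1), ε i = ε 0 * σ (x 0) (x i) := by
    intro ε hε i
    induction i using Fin.induction with
    | zero => rw [h00, mul_one]
    | succ i ih =>
      rw [← key i, ← mul_assoc, ← ih, ← (hε i).2, ← mul_assoc, sq, one_mul]
  refine ⟨fun e₀ => ⟨fun i => e₀ * σ (x 0) (x i), ⟨?_, fun i => ⟨hadj i, ?_⟩⟩, ?_⟩,
    fun ε hε i _ => main ε hε i⟩
  · simp only [h00, mul_one]
  · dsimp only
    rw [mul_mul_mul_comm, sq, one_mul, ← key i, ← mul_assoc, sq, one_mul]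
  · rintro ε ⟨h0, hε⟩
    funext i
    rw [main ε hε i, h0]
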